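/- arXiv:2008.01290 — 2 statements merged into one kernel-verified Lean document; each statement's English description precedes it below -/
import Mathlib

section
/- Let N ≥ 1, α > 0 and p > 1. There exists a constant C > 0, depending only on N, α and p, such that for all t ∈ (0, 1] and all x ∈ ℝ^N: ∫_{ℝ^N} G_t(x−y) |y|^α (1 + |y|)^{−αp/(p−1)} dy ≤ C (1 + |x|)^{−α/(p−1)}. -/
open MeasureTheory Real Set

/-- The heat kernel `G_t(x) = (4πt)^{-N/2} exp(-|x|²/(4t))` on `ℝ^N`. -/
noncomputable def heatKernel (N : ℕ) (t : ℝ) (x : EuclideanSpace ℝ (Fin N)) : ℝ :=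
  (4 * Real.pi * t) ^ (-(N : ℝ) / 2) * Real.exp (-‖x‖ ^ 2 / (4 * t))

/-- A Peetre-type inequality: translating a negative power of `1 + ‖·‖` costs a factor
`(1 + ‖x - y‖) ^ β`. -/
lemma one_add_norm_rpow_neg_le {E : Type*} [SeminormedAddCommGroup E] {β : ℝ} (hβ : 0 ≤ β)
    (x y : E) : (1 + ‖y‖) ^ (-β) ≤ (1 + ‖x - y‖) ^ β * (1 + ‖x‖) ^ (-β) := by
  have hx : 0 < 1 + ‖x‖ := by positivity
  have hy : 0 < 1 + ‖y‖ := by positivity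
  have h : 1 + ‖x‖ ≤ (1 + ‖x - y‖) * (1 + ‖y‖) := by
    nlinarith [norm_sub_norm_le x y, mul_nonneg (norm_nonneg (x - y)) (norm_nonneg y)]
  have h' := Real.rpow_le_rpow hx.le h hβ
  rw [Real.mul_rpow (by positivity) hy.le] at h'
  rw [Real.rpow_neg hx.le, Real.rpow_neg hy.le, ← div_eq_mul_inv,
    le_div_iff₀ (by positivity), inv_mul_le_iff₀ (by positivity)]
  linarith

lemma one_add_rpow_le_exp_sq {r t β : ℝ} (hr : 0 ≤ r) (ht : t ∈ Set.Ioc (0 : ℝ) 1)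
    (hβ : 0 ≤ β) : (1 + r) ^ β ≤ Real.exp (2 * β ^ 2) * Real.exp (r ^ 2 / (8 * t)) := by
  have h : r ^ 2 / 8 ≤ r ^ 2 / (8 * t) :=
    div_le_div_of_nonneg_left (sq_nonneg r) (by linarith [ht.1]) (by linarith [ht.2])
  calc (1 + r) ^ β ≤ Real.exp r ^ β :=
        Real.rpow_le_rpow (by linarith) (by linarith [Real.add_one_le_exp r]) hβ
    _ = Real.exp (r * β) := (Real.exp_mul r β).symm
    _ ≤ Real.exp (2 * β ^ 2 + r ^ 2 / (8 * t)) :=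
        Real.exp_le_exp.2 (by nlinarith [sq_nonneg (r - 4 * β)])
    _ = _ := Real.exp_add _ _

lemma heatKernel_mul_one_add_norm_rpow_le {N : ℕ} {t β : ℝ} (ht : t ∈ Set.Ioc (0 : ℝ) 1)
    (hβ : 0 ≤ β) (z : EuclideanSpace ℝ (Fin N)) :
    heatKernel N t z * (1 + ‖z‖) ^ β ≤
      Real.exp (2 * β ^ 2) * (4 * Real.pi * t) ^ (-(N : ℝ) / 2) *
        Real.exp (-(1 / (8 * t)) * ‖z‖ ^ 2) := by
  have ht0 := ht.1
  have e : Real.exp (-(1 / (8 * t)) * ‖z‖ ^ 2) =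
      Real.exp (-‖z‖ ^ 2 / (4 * t)) * Real.exp (‖z‖ ^ 2 / (8 * t)) := by
    rw [← Real.exp_add]
    congr 1
    field_simp
    ring
  rw [e, heatKernel]
  calc _ ≤ (4 * Real.pi * t) ^ (-(N : ℝ) / 2) * Real.exp (-‖z‖ ^ 2 / (4 * t)) *
        (Real.exp (2 * β ^ 2) * Real.exp (‖z‖ ^ 2 / (8 * t))) :=
        mul_le_mul_of_nonneg_left (one_add_rpow_le_exp_sq (norm_nonneg z) ht hβ) (by positivity)
    _ = _ := by ring

lemma integral_exp_neg_inv_mul_sq_norm (N : ℕ) {t : ℝ} (ht : 0 < t) :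
    ∫ z : EuclideanSpace ℝ (Fin N), Real.exp (-(1 / (8 * t)) * ‖z‖ ^ 2) =
      2 ^ ((N : ℝ) / 2) * (4 * Real.pi * t) ^ ((N : ℝ) / 2) := by
  rw [GaussianFourier.integral_rexp_neg_mul_sq_norm (by positivity), finrank_euclideanSpace_fin,
    ← Real.mul_rpow (by positivity) (by positivity)]
  congr 1
  field_simp
  ring

lemma integrable_exp_neg_inv_mul_sq_norm (N : ℕ) {t : ℝ} (ht : 0 < t) :
    Integrable fun z : EuclideanSpace ℝ (Fin N) => Real.exp (-(1 / (8 * t)) * ‖z‖ ^ 2) := by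
  refine Integrable.of_integral_ne_zero ?_
  rw [integral_exp_neg_inv_mul_sq_norm N ht]
  positivity

/-- For `N ≥ 1`, `α > 0` and `p > 1` there is `C = C(N, α, p) > 0` with
`∫ G_t(x-y) |y|^α (1+|y|)^{-αp/(p-1)} dy ≤ C (1+|x|)^{-α/(p-1)}` for all
`t ∈ (0,1]` and `x`. -/
theorem stmt_8 (N : ℕ) (hN : 1 ≤ N) (α p : ℝ) (hα : 0 < α) (hp : 1 < p) :
    ∃ C : ℝ, 0 < C ∧ ∀ t ∈ Set.Ioc (0 : ℝ) 1, ∀ x : EuclideanSpace ℝ (Fin N),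
      (∫ y, heatKernel N t (x - y) * ‖y‖ ^ α * (1 + ‖y‖) ^ (-(α * p / (p - 1)))) ≤
        C * (1 + ‖x‖) ^ (-(α / (p - 1))) := by
  set β := α / (p - 1) with hβdef
  have hp1 : 0 < p - 1 := by linarith
  have hβ : 0 ≤ β := by positivity
  have hexp : -(α * p / (p - 1)) = -α + -β := by
    rw [hβdef]
    field_simp
    ring
  refine ⟨Real.exp (2 * β ^ 2) * 2 ^ ((N : ℝ) / 2), by positivity, fun t ht x => ?_⟩
  have ht0 := ht.1
  have hker : ∀ z : EuclideanSpace ℝ (Fin N), 0 ≤ heatKernel N t z := fun z => by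
    unfold heatKernel
    positivity
  set A := Real.exp (2 * β ^ 2) * (4 * Real.pi * t) ^ (-(N : ℝ) / 2) with hA
  have hweight : ∀ y : EuclideanSpace ℝ (Fin N),
      ‖y‖ ^ α * (1 + ‖y‖) ^ (-(α * p / (p - 1))) ≤ (1 + ‖y‖) ^ (-β) := fun y => by
    have hy : 0 < 1 + ‖y‖ := by positivity
    calc _ ≤ (1 + ‖y‖) ^ α * (1 + ‖y‖) ^ (-(α * p / (p - 1))) := by
          gcongr
          linarith
      _ = _ := by
          rw [← Real.rpow_add hy, hexp]
          congr 1
          ring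
  calc _ ≤ ∫ y : EuclideanSpace ℝ (Fin N),
        (1 + ‖x‖) ^ (-β) * (A * Real.exp (-(1 / (8 * t)) * ‖x - y‖ ^ 2)) := by
        refine integral_mono_of_nonneg (ae_of_all _ fun y => ?_)
          ((((integrable_exp_neg_inv_mul_sq_norm N ht0).comp_sub_left x).const_mul A).const_mul _)
          (ae_of_all _ fun y => ?_)
        · have := hker (x - y)
          simp only [Pi.zero_apply]
          positivity
        · calc _ ≤ heatKernel N t (x - y) * ((1 + ‖x - y‖) ^ β * (1 + ‖x‖) ^ (-β)) := by
                dsimp only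
                rw [mul_assoc]
                exact mul_le_mul_of_nonneg_left
                  ((hweight y).trans (one_add_norm_rpow_neg_le hβ x y)) (hker _)
            _ = (1 + ‖x‖) ^ (-β) * (heatKernel N t (x - y) * (1 + ‖x - y‖) ^ β) := by ring
            _ ≤ _ := mul_le_mul_of_nonneg_left
                (heatKernel_mul_one_add_norm_rpow_le ht hβ (x - y)) (by positivity)
    _ = _ := by
        rw [integral_const_mul, integral_const_mul,
          integral_sub_left_eq_self
            (fun z : EuclideanSpace ℝ (Fin N) => Real.exp (-(1 / (8 * t)) * ‖z‖ ^ 2)) volume x,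
          integral_exp_neg_inv_mul_sq_norm N ht0, hA]
        have hcancel : (4 * Real.pi * t) ^ (-(N : ℝ) / 2) * (4 * Real.pi * t) ^ ((N : ℝ) / 2) = 1 := by
          rw [← Real.rpow_add (by positivity), neg_div, neg_add_cancel, Real.rpow_zero]
        linear_combination
          (Real.exp (2 * β ^ 2) * 2 ^ ((N : ℝ) / 2) * (1 + ‖x‖) ^ (-β)) * hcancel
end

section
/- Let N ≥ 1, α > 0, p > 1, let σ > −1, m ∈ ℝ, and set ν(x) = (1 + |x|)^{α/(p−1)}. Let w : ℝ^N → ℝ be continuous with sup_{x∈ℝ^N} ν(x)|w(x)| < ∞. Then for every continuous u₀ : ℝ^N → ℝ with sup_{x∈ℝ^N} ν(x)|u₀(x)| < ∞, there exist T > 0 and a continuous function u : [0,T] × ℝ^N → ℝ with sup_{t∈[0,T]} sup_{x∈ℝ^N} ν(x)|u(t,x)| < ∞ such that for all (t,x) ∈ [0,T] × ℝ^N: u(t,x) = ∫_{ℝ^N} G_t(x−y) u₀(y) dy + ∫_0^t ∫_{ℝ^N} G_{t−τ}(x−y) |y|^α |u(τ,y)|^p dy dτ + ∫_0^t ζ(τ)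 ∫_{ℝ^N} G_{t−τ}(x−y) w(y) dy dτ (with the convention u(0,x) = u₀(x)). -/
open MeasureTheory Real Set

/-- The forcing profile `ζ(t) = t^σ` for `0 < t < 1` and `ζ(t) = t^m` for `t ≥ 1`. -/
noncomputable def zeta (σ m t : ℝ) : ℝ := if t < 1 then t ^ σ else t ^ m

open Filter Topology

/-- The standard heat distribution on `ℝ^N`, with density `G_1`. -/
noncomputable def heatMeasure (N : ℕ) : Measure (EuclideanSpace ℝ (Fin N)) :=
  volume.withDensity fun z => ENNReal.ofReal (heatKernel N 1 z)

/-- The heat semigroup in rescaled variables; it is defined up to `t = 0`. -/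
noncomputable def heatFlow (N : ℕ) (f : EuclideanSpace ℝ (Fin N) → ℝ) (t : ℝ)
    (x : EuclideanSpace ℝ (Fin N)) : ℝ :=
  ∫ z, f (x - √t • z) ∂heatMeasure N

/-- The Duhamel integral `∫₀ᵗ τ^σ S(t-τ) f(τ) dτ`, rescaled to the time interval `[0,1]`. -/
noncomputable def duhamel (N : ℕ) (σ : ℝ) (f : ℝ → EuclideanSpace ℝ (Fin N) → ℝ) (t : ℝ)
    (x : EuclideanSpace ℝ (Fin N)) : ℝ :=
  t ^ (1 + σ) * ∫ s in (0 : ℝ)..1, s ^ σ * heatFlow N (f (t * s)) (t * (1 - s)) x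

/-- The reciprocal weight `(1 + |x|)^{-γ}`. -/
noncomputable def decayWeight (N : ℕ) (γ : ℝ) (x : EuclideanSpace ℝ (Fin N)) : ℝ :=
  (1 + ‖x‖) ^ (-γ)

/-- The constant `∫ G_1(z) (1 + |z|)^γ dz`. -/
noncomputable def heatMoment (N : ℕ) (γ : ℝ) : ℝ :=
  ∫ z, (1 + ‖z‖) ^ γ ∂heatMeasure N

section HeatMeasure

variable {N : ℕ}

lemma heatKernel_nonneg {t : ℝ} (ht : 0 ≤ t) (x : EuclideanSpace ℝ (Fin N)) :
    0 ≤ heatKernel N t x := by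
  unfold heatKernel; positivity

lemma continuous_heatKernel_one : Continuous (heatKernel N 1) := by
  unfold heatKernel; fun_prop

lemma integral_heatKernel_one : ∫ z, heatKernel N 1 z = 1 := by
  have h := GaussianFourier.integral_rexp_neg_mul_sq_norm
    (V := EuclideanSpace ℝ (Fin N)) (b := 1 / 4) (by norm_num)
  have h2 : ∀ z : EuclideanSpace ℝ (Fin N), heatKernel N 1 z =
      (4 * π) ^ (-(N : ℝ) / 2) * rexp (-(1 / 4) * ‖z‖ ^ 2) := by
    intro z
    unfold heatKernel
    congr 2
    · ring
    · ring
  simp_rw [h2]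
  rw [integral_const_mul, h, finrank_euclideanSpace, Fintype.card_fin,
    show π / (1 / 4) = 4 * π by ring, ← Real.rpow_add (by positivity)]
  rw [show -(N : ℝ) / 2 + N / 2 = 0 by ring, Real.rpow_zero]

instance isProbabilityMeasure_heatMeasure : IsProbabilityMeasure (heatMeasure N) := by
  constructor
  have hi : Integrable (heatKernel N 1) := by
    apply Integrable.of_integral_ne_zero
    rw [integral_heatKernel_one]
    exact one_ne_zero
  rw [heatMeasure, withDensity_apply _ MeasurableSet.univ, Measure.restrict_univ,
    ← ofReal_integral_eq_lintegral_ofReal hi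
      (Eventually.of_forall fun z => heatKernel_nonneg zero_le_one z),
    integral_heatKernel_one, ENNReal.ofReal_one]

lemma integral_heatMeasure (f : EuclideanSpace ℝ (Fin N) → ℝ) :
    ∫ z, f z ∂heatMeasure N = ∫ z, heatKernel N 1 z * f z := by
  rw [heatMeasure, integral_withDensity_eq_integral_toReal_smul
    (by exact continuous_heatKernel_one.measurable.ennreal_ofReal) (by simp)]
  simp [ENNReal.toReal_ofReal, heatKernel_nonneg]

lemma integrable_heatMeasure_rpow {γ : ℝ} (hγ : 0 ≤ γ) :
    Integrable (fun z : EuclideanSpace ℝ (Fin N) => (1 + ‖z‖) ^ γ) (heatMeasure N) := by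
  have hcont : Continuous fun z : EuclideanSpace ℝ (Fin N) => (1 + ‖z‖) ^ γ :=
    Continuous.rpow_const (by fun_prop) fun _ => Or.inr hγ
  rw [heatMeasure, integrable_withDensity_iff
    (by exact continuous_heatKernel_one.measurable.ennreal_ofReal) (by simp)]
  have hexp : Integrable fun z : EuclideanSpace ℝ (Fin N) => rexp (-(1 / 8) * ‖z‖ ^ 2) := by
    apply Integrable.of_integral_ne_zero
    rw [GaussianFourier.integral_rexp_neg_mul_sq_norm (by norm_num)]
    positivity
  refine (hexp.const_mul (rexp (2 * γ ^ 2) * (4 * π * 1) ^ (-(N : ℝ) / 2))).mono' ?_ ?_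
  · exact (hcont.measurable.mul
      continuous_heatKernel_one.measurable.ennreal_ofReal.ennreal_toReal).aestronglyMeasurable
  · refine Eventually.of_forall fun z => ?_
    rw [ENNReal.toReal_ofReal (heatKernel_nonneg zero_le_one z),
      Real.norm_of_nonneg (mul_nonneg (by positivity) (heatKernel_nonneg zero_le_one z))]
    have hb : (1 + ‖z‖) ^ γ ≤ rexp (2 * γ ^ 2 + 1 / 8 * ‖z‖ ^ 2) := by
      rw [Real.rpow_def_of_pos (by positivity)]
      apply Real.exp_le_exp.2
      have hlog := Real.log_le_sub_one_of_pos (show 0 < 1 + ‖z‖ by positivity)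
      nlinarith [mul_le_mul_of_nonneg_right hlog hγ, sq_nonneg (‖z‖ - 4 * γ)]
    unfold heatKernel
    calc _ ≤ rexp (2 * γ ^ 2 + 1 / 8 * ‖z‖ ^ 2) *
          ((4 * π * 1) ^ (-(N : ℝ) / 2) * rexp (-‖z‖ ^ 2 / (4 * 1))) := by gcongr
      _ = _ := by
        have hexponent : rexp (2 * γ ^ 2 + 1 / 8 * ‖z‖ ^ 2) * rexp (-‖z‖ ^ 2 / (4 * 1)) =
            rexp (2 * γ ^ 2) * rexp (-(1 / 8) * ‖z‖ ^ 2) := by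
          rw [← Real.exp_add, ← Real.exp_add]
          congr 1
          ring
        rw [mul_left_comm, hexponent, mul_left_comm, ← mul_assoc]

lemma heatMoment_nonneg (γ : ℝ) : 0 ≤ heatMoment N γ :=
  integral_nonneg fun _ => by positivity

end HeatMeasure

section HeatFlow

variable {N : ℕ}

lemma heatFlow_zero (f : EuclideanSpace ℝ (Fin N) → ℝ) (x : EuclideanSpace ℝ (Fin N)) :
    heatFlow N f 0 x = f x := by
  simp [heatFlow]

lemma heatFlow_eq_integral_heatKernel (f : EuclideanSpace ℝ (Fin N) → ℝ) {t : ℝ} (ht : 0 < t)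
    (x : EuclideanSpace ℝ (Fin N)) :
    heatFlow N f t x = ∫ y, heatKernel N t (x - y) * f y := by
  have h1 : ∫ y, heatKernel N t (x - y) * f y = ∫ y, heatKernel N t y * f (x - y) := by
    rw [← integral_sub_left_eq_self (fun y => heatKernel N t y * f (x - y)) volume x]
    simp
  have hsq : √t ^ N = t ^ ((N : ℝ) / 2) := by
    rw [Real.sqrt_eq_rpow, ← Real.rpow_natCast, ← Real.rpow_mul ht.le]
    congr 1
    ring
  have hk : ∀ z : EuclideanSpace ℝ (Fin N),
      heatKernel N t (√t • z) = (√t ^ N)⁻¹ * heatKernel N 1 z := by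
    intro z
    have hexponent : -‖√t • z‖ ^ 2 / (4 * t) = -‖z‖ ^ 2 / (4 * 1) := by
      rw [norm_smul, mul_pow, Real.norm_of_nonneg (Real.sqrt_nonneg t), Real.sq_sqrt ht.le]
      field_simp
    unfold heatKernel
    rw [hexponent, hsq, Real.mul_rpow (by positivity) ht.le, mul_one, neg_div,
      Real.rpow_neg ht.le, mul_comm (_ ^ _), mul_assoc, mul_one]
  have h2 := Measure.integral_comp_smul (volume : Measure (EuclideanSpace ℝ (Fin N)))
    (fun y => heatKernel N t y * f (x - y)) √t
  simp only [hk, mul_assoc] at h2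
  rw [integral_const_mul, finrank_euclideanSpace, Fintype.card_fin,
    abs_of_nonneg (by positivity), smul_eq_mul] at h2
  rw [h1, heatFlow, integral_heatMeasure]
  exact mul_left_cancel₀ (by positivity) h2

lemma decayWeight_pos (γ : ℝ) (x : EuclideanSpace ℝ (Fin N)) : 0 < decayWeight N γ x := by
  unfold decayWeight; positivity

lemma decayWeight_le_one {γ : ℝ} (hγ : 0 ≤ γ) (x : EuclideanSpace ℝ (Fin N)) :
    decayWeight N γ x ≤ 1 :=
  Real.rpow_le_one_of_one_le_of_nonpos (by simp) (by simpa)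

lemma continuous_decayWeight (γ : ℝ) : Continuous (decayWeight N γ) :=
  Continuous.rpow_const (by fun_prop) fun x => Or.inl (by positivity)

lemma abs_le_mul_decayWeight {γ B a : ℝ} {x : EuclideanSpace ℝ (Fin N)}
    (h : (1 + ‖x‖) ^ γ * |a| ≤ B) : |a| ≤ B * decayWeight N γ x := by
  rw [decayWeight, Real.rpow_neg (by positivity), ← div_eq_mul_inv, le_div_iff₀ (by positivity)]
  linarith

lemma decayWeight_sub_le {γ t : ℝ} (hγ : 0 ≤ γ) (ht : t ≤ 1)
    (x z : EuclideanSpace ℝ (Fin N)) :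
    decayWeight N γ (x - √t • z) ≤ decayWeight N γ x * (1 + ‖z‖) ^ γ := by
  have hs : ‖√t • z‖ ≤ ‖z‖ := by
    rw [norm_smul, Real.norm_of_nonneg (Real.sqrt_nonneg t)]
    exact mul_le_of_le_one_left (norm_nonneg z) (Real.sqrt_le_one.2 ht)
  have hx : 1 + ‖x‖ ≤ (1 + ‖x - √t • z‖) * (1 + ‖z‖) := by
    have := norm_add_le (x - √t • z) (√t • z)
    rw [sub_add_cancel] at this
    nlinarith [norm_nonneg (x - √t • z), norm_nonneg z]
  have hr := Real.rpow_le_rpow (by positivity) hx hγ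
  rw [Real.mul_rpow (by positivity) (by positivity)] at hr
  unfold decayWeight
  rw [Real.rpow_neg (by positivity), Real.rpow_neg (by positivity), inv_mul_eq_div,
    inv_eq_one_div, div_le_div_iff₀ (by positivity) (by positivity)]
  linarith

lemma abs_heatFlow_le {γ B t : ℝ} (hγ : 0 ≤ γ) (ht : t ≤ 1)
    {f : EuclideanSpace ℝ (Fin N) → ℝ} (hB : 0 ≤ B) (hf : ∀ y, |f y| ≤ B * decayWeight N γ y)
    (x : EuclideanSpace ℝ (Fin N)) :
    |heatFlow N f t x| ≤ B * heatMoment N γ * decayWeight N γ x := by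
  have h : ∀ z, ‖f (x - √t • z)‖ ≤ B * decayWeight N γ x * (1 + ‖z‖) ^ γ := fun z => by
    rw [mul_assoc]
    exact (hf _).trans (mul_le_mul_of_nonneg_left (decayWeight_sub_le hγ ht x z) hB)
  have := norm_integral_le_of_norm_le ((integrable_heatMeasure_rpow hγ).const_mul _)
    (Eventually.of_forall h)
  rw [integral_const_mul, Real.norm_eq_abs] at this
  calc _ ≤ _ := this
    _ = _ := by rw [heatMoment]; ring

lemma continuous_heatFlow {X : Type*} [TopologicalSpace X] [FirstCountableTopology X]
    {f : X → EuclideanSpace ℝ (Fin N) → ℝ} {t : X → ℝ} {x : X → EuclideanSpace ℝ (Fin N)} {B : ℝ}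
    (hf : Continuous fun q : X × EuclideanSpace ℝ (Fin N) => f q.1 q.2) (ht : Continuous t)
    (hx : Continuous x) (hB : ∀ a y, |f a y| ≤ B) :
    Continuous fun a => heatFlow N (f a) (t a) (x a) := by
  refine continuous_of_dominated (bound := fun _ => B) (fun a => ?_)
    (fun a => Eventually.of_forall fun z => hB _ _) (integrable_const B)
    (Eventually.of_forall fun z => ?_)
  · exact (hf.comp (f := fun z => (a, x a - √(t a) • z)) (by fun_prop)).aestronglyMeasurable
  · exact hf.comp (f := fun a => (a, x a - √(t a) • z)) (by fun_prop)

lemma heatFlow_sub {f g : EuclideanSpace ℝ (Fin N) → ℝ} {B C : ℝ}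
    (hf : Continuous f) (hg : Continuous g) (hfB : ∀ y, |f y| ≤ B) (hgC : ∀ y, |g y| ≤ C)
    (t : ℝ) (x : EuclideanSpace ℝ (Fin N)) :
    heatFlow N (fun y => f y - g y) t x = heatFlow N f t x - heatFlow N g t x := by
  have aux : ∀ {h : EuclideanSpace ℝ (Fin N) → ℝ} {D : ℝ}, Continuous h → (∀ y, |h y| ≤ D) →
      Integrable (fun z => h (x - √t • z)) (heatMeasure N) := fun {h D} hc hD =>
    (integrable_const D).mono' (hc.comp (by fun_prop)).aestronglyMeasurable
      (Eventually.of_forall fun z => hD _)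
  exact integral_sub (aux hf hfB) (aux hg hgC)

end HeatFlow

section Duhamel

variable {N : ℕ} {σ : ℝ}

lemma continuous_duhamel_integrand {f : ℝ → EuclideanSpace ℝ (Fin N) → ℝ} {B : ℝ}
    (hf : Continuous fun q : ℝ × EuclideanSpace ℝ (Fin N) => f q.1 q.2)
    (hB : ∀ t y, |f t y| ≤ B) :
    Continuous fun q : (ℝ × EuclideanSpace ℝ (Fin N)) × ℝ =>
      heatFlow N (f (q.1.1 * q.2)) (q.1.1 * (1 - q.2)) q.1.2 := by
  refine continuous_heatFlow (X := (ℝ × EuclideanSpace ℝ (Fin N)) × ℝ)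
    (f := fun q y => f (q.1.1 * q.2) y) ?_ (by fun_prop) (by fun_prop) (fun a y => hB _ _)
  exact hf.comp (f := fun q : ((ℝ × EuclideanSpace ℝ (Fin N)) × ℝ) × EuclideanSpace ℝ (Fin N) =>
    (q.1.1.1 * q.1.2, q.2)) (by fun_prop)

lemma abs_heatFlow_le_of_bounded {f : EuclideanSpace ℝ (Fin N) → ℝ} {B : ℝ}
    (hB : ∀ y, |f y| ≤ B) (t : ℝ) (x : EuclideanSpace ℝ (Fin N)) : |heatFlow N f t x| ≤ B := by
  have := norm_integral_le_of_norm_le_const (μ := heatMeasure N)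
    (f := fun z => f (x - √t • z)) (Eventually.of_forall fun z => hB (x - √t • z))
  simpa [heatFlow] using this

lemma measurable_duhamel_integrand {f : ℝ → EuclideanSpace ℝ (Fin N) → ℝ} {B : ℝ}
    (hf : Continuous fun q : ℝ × EuclideanSpace ℝ (Fin N) => f q.1 q.2)
    (hB : ∀ t y, |f t y| ≤ B) (t : ℝ) (x : EuclideanSpace ℝ (Fin N)) :
    Measurable fun s : ℝ => s ^ σ * heatFlow N (f (t * s)) (t * (1 - s)) x :=
  (measurable_id.pow_const σ).mul ((continuous_duhamel_integrand hf hB).comp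
    (f := fun s : ℝ => ((t, x), s)) (by fun_prop)).measurable

lemma continuous_duhamel (hσ : -1 < σ) {f : ℝ → EuclideanSpace ℝ (Fin N) → ℝ} {B : ℝ}
    (hf : Continuous fun q : ℝ × EuclideanSpace ℝ (Fin N) => f q.1 q.2)
    (hB : ∀ t y, |f t y| ≤ B) :
    Continuous fun q : ℝ × EuclideanSpace ℝ (Fin N) => duhamel N σ f q.1 q.2 := by
  refine ((Real.continuous_rpow_const (by linarith)).comp continuous_fst).mul ?_
  refine intervalIntegral.continuous_of_dominated_interval (bound := fun s => |s ^ σ| * B)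
    (fun q => (measurable_duhamel_integrand hf hB q.1 q.2).aestronglyMeasurable) (fun q => ?_)
    ((intervalIntegral.intervalIntegrable_rpow' hσ).abs.mul_const B) ?_
  · refine Eventually.of_forall fun s _ => ?_
    rw [norm_mul, Real.norm_eq_abs, Real.norm_eq_abs]
    exact mul_le_mul_of_nonneg_left (abs_heatFlow_le_of_bounded (hB _) _ _) (abs_nonneg _)
  · refine Eventually.of_forall fun s _ => continuous_const.mul ?_
    exact (continuous_duhamel_integrand hf hB).comp
      (f := fun q : ℝ × EuclideanSpace ℝ (Fin N) => (q, s)) (by fun_prop)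

lemma duhamel_sub (hσ : -1 < σ) {f g : ℝ → EuclideanSpace ℝ (Fin N) → ℝ} {B C : ℝ}
    (hf : Continuous fun q : ℝ × EuclideanSpace ℝ (Fin N) => f q.1 q.2)
    (hg : Continuous fun q : ℝ × EuclideanSpace ℝ (Fin N) => g q.1 q.2)
    (hB : ∀ t y, |f t y| ≤ B) (hC : ∀ t y, |g t y| ≤ C) (t : ℝ) (x : EuclideanSpace ℝ (Fin N)) :
    duhamel N σ f t x - duhamel N σ g t x = duhamel N σ (fun t y => f t y - g t y) t x := by
  have aux : ∀ {h : ℝ → EuclideanSpace ℝ (Fin N) → ℝ} {D : ℝ},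
      (Continuous fun q : ℝ × EuclideanSpace ℝ (Fin N) => h q.1 q.2) → (∀ t y, |h t y| ≤ D) →
      IntervalIntegrable (fun s => s ^ σ * heatFlow N (h (t * s)) (t * (1 - s)) x)
        volume 0 1 := fun {h D} hc hD => by
    refine ((intervalIntegral.intervalIntegrable_rpow' hσ).abs.mul_const D).mono_fun'
      (measurable_duhamel_integrand hc hD t x).aestronglyMeasurable
      (Eventually.of_forall fun s => ?_)
    dsimp only
    rw [norm_mul, Real.norm_eq_abs, Real.norm_eq_abs]
    exact mul_le_mul_of_nonneg_left (abs_heatFlow_le_of_bounded (hD _) _ _) (abs_nonneg _)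
  rw [duhamel, duhamel, duhamel, ← mul_sub,
    ← intervalIntegral.integral_sub (aux hf hB) (aux hg hC)]
  congr 1
  refine intervalIntegral.integral_congr fun s _ => ?_
  have hft : Continuous (f (t * s)) := hf.comp (f := fun y => (t * s, y)) (by fun_prop)
  have hgt : Continuous (g (t * s)) := hg.comp (f := fun y => (t * s, y)) (by fun_prop)
  rw [← mul_sub, heatFlow_sub hft hgt (hB _) (hC _)]

lemma abs_duhamel_le {γ B t : ℝ} (hσ : -1 < σ) (hγ : 0 ≤ γ) (hB : 0 ≤ B) (ht0 : 0 ≤ t)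
    (ht1 : t ≤ 1) {f : ℝ → EuclideanSpace ℝ (Fin N) → ℝ}
    (hf : ∀ t y, |f t y| ≤ B * decayWeight N γ y) (x : EuclideanSpace ℝ (Fin N)) :
    |duhamel N σ f t x| ≤
      t ^ (1 + σ) / (1 + σ) * (B * heatMoment N γ) * decayWeight N γ x := by
  have h := intervalIntegral.norm_integral_le_of_norm_le (μ := volume) (a := 0) (b := 1)
    (f := fun s => s ^ σ * heatFlow N (f (t * s)) (t * (1 - s)) x)
    (g := fun s => s ^ σ * (B * heatMoment N γ * decayWeight N γ x)) zero_le_one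
    (Eventually.of_forall fun s hs => by
      rw [norm_mul, Real.norm_of_nonneg (Real.rpow_nonneg hs.1.le σ), Real.norm_eq_abs]
      refine mul_le_mul_of_nonneg_left (abs_heatFlow_le hγ ?_ hB (hf _) x)
        (Real.rpow_nonneg hs.1.le σ)
      nlinarith [hs.1, hs.2])
    ((intervalIntegral.intervalIntegrable_rpow' hσ).mul_const _)
  rw [intervalIntegral.integral_mul_const, integral_rpow (Or.inl hσ), Real.one_rpow,
    Real.zero_rpow (by linarith), Real.norm_eq_abs] at h
  rw [duhamel, abs_mul, abs_of_nonneg (Real.rpow_nonneg ht0 _)]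
  calc _ ≤ t ^ (1 + σ) * ((1 - 0) / (σ + 1) * (B * heatMoment N γ * decayWeight N γ x)) :=
        mul_le_mul_of_nonneg_left h (Real.rpow_nonneg ht0 _)
    _ = _ := by rw [add_comm σ 1]; ring

lemma duhamel_eq_integral_heatKernel (f : ℝ → EuclideanSpace ℝ (Fin N) → ℝ) {t : ℝ} (ht : 0 < t)
    (x : EuclideanSpace ℝ (Fin N)) :
    duhamel N σ f t x =
      ∫ τ in (0 : ℝ)..t, τ ^ σ * ∫ y, heatKernel N (t - τ) (x - y) * f τ y := by
  have h1 : ∫ τ in (0 : ℝ)..t, τ ^ σ * ∫ y, heatKernel N (t - τ) (x - y) * f τ y =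
      ∫ τ in (0 : ℝ)..t, τ ^ σ * heatFlow N (f τ) (t - τ) x := by
    refine intervalIntegral.integral_congr_ae ?_
    filter_upwards [compl_mem_ae_iff.2 (measure_singleton t)] with τ hτ hmem
    rw [uIoc_of_le ht.le] at hmem
    rw [heatFlow_eq_integral_heatKernel _ (sub_pos.2 (lt_of_le_of_ne hmem.2 hτ))]
  have h2 := intervalIntegral.mul_integral_comp_mul_left (a := 0) (b := 1)
    (f := fun τ => τ ^ σ * heatFlow N (f τ) (t - τ) x) t
  rw [mul_zero, mul_one] at h2
  rw [h1, ← h2, duhamel, Real.rpow_add ht, Real.rpow_one, mul_assoc,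
    ← intervalIntegral.integral_const_mul]
  congr 1
  refine intervalIntegral.integral_congr fun s hs => ?_
  rw [uIcc_of_le zero_le_one] at hs
  rw [Real.mul_rpow ht.le hs.1, mul_assoc, show t * (1 - s) = t - t * s by ring]

end Duhamel

section Picard

lemma abs_rpow_abs_sub_rpow_abs_le {p M a b : ℝ} (hp : 1 ≤ p) (ha : |a| ≤ M) (hb : |b| ≤ M) :
    |(|a| ^ p) - |b| ^ p| ≤ p * M ^ (p - 1) * |a - b| := by
  have h := (convex_Icc (0 : ℝ) M).norm_image_sub_le_of_norm_hasDerivWithin_le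
    (f := fun x : ℝ => x ^ p) (f' := fun x => p * x ^ (p - 1)) (C := p * M ^ (p - 1))
    (fun x _ => (Real.hasDerivAt_rpow_const (Or.inr hp)).hasDerivWithinAt)
    (fun x hx => by
      have := Real.rpow_le_rpow hx.1 hx.2 (sub_nonneg.2 hp)
      have h0 := Real.rpow_nonneg hx.1 (p - 1)
      rw [Real.norm_of_nonneg (by positivity)]
      gcongr)
    ⟨abs_nonneg b, hb⟩ ⟨abs_nonneg a, ha⟩
  have hM : 0 ≤ M := (abs_nonneg a).trans ha
  exact h.trans (mul_le_mul_of_nonneg_left (abs_abs_sub_abs_le a b) (by positivity))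

variable {N : ℕ} {α p σ : ℝ}

lemma norm_rpow_mul_decayWeight_rpow_le (hα : 0 ≤ α) (hp : 1 < p)
    (y : EuclideanSpace ℝ (Fin N)) :
    ‖y‖ ^ α * decayWeight N (α / (p - 1)) y ^ p ≤ decayWeight N (α / (p - 1)) y := by
  have hp' : p - 1 ≠ 0 := by linarith
  have h1 : ‖y‖ ^ α ≤ (1 + ‖y‖) ^ α := Real.rpow_le_rpow (norm_nonneg y) (by linarith) hα
  calc _ ≤ (1 + ‖y‖) ^ α * decayWeight N (α / (p - 1)) y ^ p :=
        mul_le_mul_of_nonneg_right h1 (Real.rpow_nonneg (decayWeight_pos _ y).le p)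
    _ = _ := by
      unfold decayWeight
      rw [← Real.rpow_mul (by positivity), ← Real.rpow_add (by positivity)]
      congr 1
      field_simp
      ring

/-- The nonlinearity `|y|^α |u|^p` evaluated at `u = (1 + |y|)^{-α/(p-1)} v`. -/
noncomputable def reaction (N : ℕ) (α p : ℝ) (v : ℝ × EuclideanSpace ℝ (Fin N) → ℝ) (t : ℝ)
    (y : EuclideanSpace ℝ (Fin N)) : ℝ :=
  ‖y‖ ^ α * |decayWeight N (α / (p - 1)) y * v (t, y)| ^ p

lemma reaction_eq (v : ℝ × EuclideanSpace ℝ (Fin N) → ℝ) (t : ℝ)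
    (y : EuclideanSpace ℝ (Fin N)) :
    reaction N α p v t y =
      ‖y‖ ^ α * decayWeight N (α / (p - 1)) y ^ p * |v (t, y)| ^ p := by
  rw [reaction, abs_mul, abs_of_pos (decayWeight_pos _ y),
    Real.mul_rpow (decayWeight_pos _ y).le (abs_nonneg _), mul_assoc]

lemma continuous_reaction (hα : 0 ≤ α) (hp : 1 < p) {v : ℝ × EuclideanSpace ℝ (Fin N) → ℝ}
    (hv : Continuous v) :
    Continuous fun q : ℝ × EuclideanSpace ℝ (Fin N) => reaction N α p v q.1 q.2 := by
  have hw := continuous_decayWeight (N := N) (α / (p - 1))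
  exact (Continuous.rpow_const (by fun_prop) fun _ => Or.inr hα).mul
    (Continuous.rpow_const (by fun_prop) fun _ => Or.inr (by linarith))

lemma abs_reaction_le (hα : 0 ≤ α) (hp : 1 < p) {v : ℝ × EuclideanSpace ℝ (Fin N) → ℝ} {R : ℝ}
    (hv : ∀ q, |v q| ≤ R) (t : ℝ) (y : EuclideanSpace ℝ (Fin N)) :
    |reaction N α p v t y| ≤ R ^ p * decayWeight N (α / (p - 1)) y := by
  have hw := (decayWeight_pos (α / (p - 1)) y).le
  have hR := Real.rpow_le_rpow (abs_nonneg _) (hv (t, y)) (by linarith : 0 ≤ p)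
  rw [reaction_eq, abs_of_nonneg (by positivity), mul_comm]
  exact mul_le_mul hR (norm_rpow_mul_decayWeight_rpow_le hα hp y) (by positivity)
    ((Real.rpow_nonneg (abs_nonneg _) p).trans hR)

lemma abs_reaction_sub_le (hα : 0 ≤ α) (hp : 1 < p) {v v' : ℝ × EuclideanSpace ℝ (Fin N) → ℝ}
    {R d : ℝ} (hv : ∀ q, |v q| ≤ R) (hv' : ∀ q, |v' q| ≤ R) (hd : ∀ q, |v q - v' q| ≤ d) (t : ℝ)
    (y : EuclideanSpace ℝ (Fin N)) :
    |reaction N α p v t y - reaction N α p v' t y| ≤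
      p * R ^ (p - 1) * d * decayWeight N (α / (p - 1)) y := by
  have hw := (decayWeight_pos (α / (p - 1)) y).le
  have hR : 0 ≤ R := (abs_nonneg _).trans (hv (t, y))
  have hd0 : 0 ≤ d := (abs_nonneg _).trans (hd (t, y))
  have hdiff : |(|v (t, y)| ^ p) - |v' (t, y)| ^ p| ≤ p * R ^ (p - 1) * d :=
    (abs_rpow_abs_sub_rpow_abs_le hp.le (hv _) (hv' _)).trans
      (mul_le_mul_of_nonneg_left (hd _) (by positivity))
  rw [reaction_eq, reaction_eq, ← mul_sub, abs_mul,
    abs_of_nonneg (show 0 ≤ ‖y‖ ^ α * decayWeight N (α / (p - 1)) y ^ p by positivity),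
    mul_comm (‖y‖ ^ α * _)]
  exact mul_le_mul hdiff (norm_rpow_mul_decayWeight_rpow_le hα hp y) (by positivity)
    (by positivity)

/-- The right-hand side of the integral equation for `u = (1 + |x|)^{-α/(p-1)} v`, multiplied by
`(1 + |x|)^{α/(p-1)}`. -/
noncomputable def picardMap (N : ℕ) (α p σ : ℝ) (u₀ w : EuclideanSpace ℝ (Fin N) → ℝ)
    (v : ℝ × EuclideanSpace ℝ (Fin N) → ℝ) (t : ℝ) (x : EuclideanSpace ℝ (Fin N)) : ℝ :=
  (decayWeight N (α / (p - 1)) x)⁻¹ *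
    (heatFlow N u₀ t x + duhamel N 0 (reaction N α p v) t x + duhamel N σ (fun _ => w) t x)

lemma abs_le_of_le_mul_decayWeight {γ B a : ℝ} (hγ : 0 ≤ γ) (hB : 0 ≤ B)
    {x : EuclideanSpace ℝ (Fin N)} (h : |a| ≤ B * decayWeight N γ x) : |a| ≤ B :=
  h.trans (mul_le_of_le_one_right hB (decayWeight_le_one hγ x))

variable {u₀ w : EuclideanSpace ℝ (Fin N) → ℝ} {B₀ B₁ R t : ℝ}
  {v v' : ℝ × EuclideanSpace ℝ (Fin N) → ℝ}

lemma continuous_picardMap (hα : 0 ≤ α) (hp : 1 < p) (hσ : -1 < σ) (hB₀ : 0 ≤ B₀) (hB₁ : 0 ≤ B₁)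
    (hR : 0 ≤ R) (hu₀c : Continuous u₀) (hwc : Continuous w)
    (hu₀ : ∀ y, |u₀ y| ≤ B₀ * decayWeight N (α / (p - 1)) y)
    (hw : ∀ y, |w y| ≤ B₁ * decayWeight N (α / (p - 1)) y)
    (hvc : Continuous v) (hv : ∀ q, |v q| ≤ R) :
    Continuous fun q : ℝ × EuclideanSpace ℝ (Fin N) => picardMap N α p σ u₀ w v q.1 q.2 := by
  have hγ : 0 ≤ α / (p - 1) := div_nonneg hα (by linarith)
  have hW : Continuous fun q : ℝ × EuclideanSpace ℝ (Fin N) =>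
      (decayWeight N (α / (p - 1)) q.2)⁻¹ :=
    ((continuous_decayWeight _).comp continuous_snd).inv₀ fun q => (decayWeight_pos _ _).ne'
  refine hW.mul (((continuous_heatFlow (f := fun _ => u₀) (hu₀c.comp continuous_snd)
    continuous_fst continuous_snd
    fun _ y => abs_le_of_le_mul_decayWeight hγ hB₀ (hu₀ y)).add ?_).add ?_)
  · exact continuous_duhamel (by norm_num) (continuous_reaction hα hp hvc) fun t y =>
      abs_le_of_le_mul_decayWeight hγ (Real.rpow_nonneg hR p) (abs_reaction_le hα hp hv t y)
  · exact continuous_duhamel hσ (hwc.comp continuous_snd) fun _ y =>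
      abs_le_of_le_mul_decayWeight hγ hB₁ (hw y)

lemma abs_picardMap_le (hα : 0 ≤ α) (hp : 1 < p) (hσ : -1 < σ) (hB₀ : 0 ≤ B₀) (hB₁ : 0 ≤ B₁)
    (hR : 0 ≤ R) (hu₀ : ∀ y, |u₀ y| ≤ B₀ * decayWeight N (α / (p - 1)) y)
    (hw : ∀ y, |w y| ≤ B₁ * decayWeight N (α / (p - 1)) y) (hv : ∀ q, |v q| ≤ R)
    (ht0 : 0 ≤ t) (ht1 : t ≤ 1) (x : EuclideanSpace ℝ (Fin N)) :
    |picardMap N α p σ u₀ w v t x| ≤ B₀ * heatMoment N (α / (p - 1)) +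
      t * (R ^ p * heatMoment N (α / (p - 1))) +
      t ^ (1 + σ) / (1 + σ) * (B₁ * heatMoment N (α / (p - 1))) := by
  have hγ : 0 ≤ α / (p - 1) := div_nonneg hα (by linarith)
  have hW := decayWeight_pos (α / (p - 1)) x
  have h1 := abs_heatFlow_le hγ ht1 hB₀ hu₀ x
  have h2 := abs_duhamel_le (σ := 0) (by norm_num) hγ (Real.rpow_nonneg hR p) ht0 ht1
    (abs_reaction_le hα hp hv) x
  have h3 := abs_duhamel_le hσ hγ hB₁ ht0 ht1 (fun _ => hw) x
  rw [add_zero, Real.rpow_one, div_one] at h2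
  rw [picardMap, abs_mul, abs_of_pos (inv_pos.2 hW), inv_mul_le_iff₀ hW]
  refine (abs_add_three _ _ _).trans ?_
  linarith

lemma abs_picardMap_sub_le (hα : 0 ≤ α) (hp : 1 < p) (hvc : Continuous v) (hvc' : Continuous v')
    (hv : ∀ q, |v q| ≤ R) (hv' : ∀ q, |v' q| ≤ R) {d : ℝ} (hd : ∀ q, |v q - v' q| ≤ d)
    (ht0 : 0 ≤ t) (ht1 : t ≤ 1) (x : EuclideanSpace ℝ (Fin N)) :
    |picardMap N α p σ u₀ w v t x - picardMap N α p σ u₀ w v' t x| ≤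
      t * (p * R ^ (p - 1) * heatMoment N (α / (p - 1))) * d := by
  have hγ : 0 ≤ α / (p - 1) := div_nonneg hα (by linarith)
  have hW := decayWeight_pos (α / (p - 1)) x
  have hR : 0 ≤ R := (abs_nonneg _).trans (hv 0)
  have hd0 : 0 ≤ d := (abs_nonneg _).trans (hd 0)
  have hbound : ∀ {v : ℝ × EuclideanSpace ℝ (Fin N) → ℝ}, (∀ q, |v q| ≤ R) →
      ∀ t y, |reaction N α p v t y| ≤ R ^ p := fun hv t y =>
    abs_le_of_le_mul_decayWeight hγ (Real.rpow_nonneg hR p) (abs_reaction_le hα hp hv t y)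
  have h := abs_duhamel_le (σ := 0) (by norm_num) hγ (B := p * R ^ (p - 1) * d)
    (by positivity) ht0 ht1 (abs_reaction_sub_le hα hp hv hv' hd) x
  rw [add_zero, Real.rpow_one, div_one, ← duhamel_sub (by norm_num) (continuous_reaction hα hp hvc)
    (continuous_reaction hα hp hvc') (hbound hv) (hbound hv')] at h
  rw [picardMap, picardMap, ← mul_sub, abs_mul, abs_of_pos (inv_pos.2 hW), inv_mul_le_iff₀ hW]
  rw [add_sub_add_right_eq_sub, add_sub_add_left_eq_sub]
  linarith

end Picard

lemma exists_small_time {σ : ℝ} (hσ : -1 < σ) (a b c : ℝ) :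
    ∃ T : ℝ, 0 < T ∧ T < 1 ∧ T * a + T ^ (1 + σ) / (1 + σ) * b < 1 ∧ T * c < 1 / 2 := by
  have hcont := Real.continuous_rpow_const (show 0 ≤ 1 + σ by linarith)
  have h1 : ∀ᶠ T : ℝ in 𝓝 0, T * a + T ^ (1 + σ) / (1 + σ) * b < 1 := by
    have : Continuous fun T : ℝ => T * a + T ^ (1 + σ) / (1 + σ) * b := by fun_prop
    refine this.continuousAt.eventually_lt continuousAt_const ?_
    simp [Real.zero_rpow (show 1 + σ ≠ 0 by linarith)]
  have h2 : ∀ᶠ T : ℝ in 𝓝 0, T * c < 1 / 2 :=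
    (continuous_mul_const c).continuousAt.eventually_lt continuousAt_const (by simp)
  obtain ⟨T, ⟨⟨h1, h2⟩, h3⟩, h4⟩ :=
    ((((h1.and h2).and (eventually_lt_nhds zero_lt_one)).filter_mono nhdsWithin_le_nhds).and
      (self_mem_nhdsWithin (s := Ioi (0 : ℝ)))).exists
  exact ⟨T, h4, h3, h1, h2⟩

/-- A continuous bounded fixed point of the Picard map on a short time interval. -/
lemma exists_picardMap_fixedPoint {N : ℕ} {α p σ B₀ B₁ : ℝ} (hα : 0 ≤ α) (hp : 1 < p)
    (hσ : -1 < σ) {u₀ w : EuclideanSpace ℝ (Fin N) → ℝ} (hu₀c : Continuous u₀)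
    (hwc : Continuous w) (hB₀ : 0 ≤ B₀) (hB₁ : 0 ≤ B₁)
    (hu₀ : ∀ y, |u₀ y| ≤ B₀ * decayWeight N (α / (p - 1)) y)
    (hw : ∀ y, |w y| ≤ B₁ * decayWeight N (α / (p - 1)) y) :
    ∃ T : ℝ, 0 < T ∧ T < 1 ∧ ∃ v : BoundedContinuousFunction (ℝ × EuclideanSpace ℝ (Fin N)) ℝ,
      ∀ t ∈ Icc 0 T, ∀ x, v (t, x) = picardMap N α p σ u₀ w v t x := by
  set C := heatMoment N (α / (p - 1))
  have hC : 0 ≤ C := heatMoment_nonneg _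
  set M := B₀ * C + 1
  have hM : 0 ≤ M := by positivity
  obtain ⟨T, hT0, hT1, hself, hcontr⟩ :=
    exists_small_time hσ (M ^ p * C) (B₁ * C) (p * M ^ (p - 1) * C)
  have hτ0 : ∀ t : ℝ, 0 ≤ max 0 (min t T) := fun t => le_max_left _ _
  have hτT : ∀ t : ℝ, max 0 (min t T) ≤ T := fun t => max_le hT0.le (min_le_right _ _)
  have hτ1 : ∀ t : ℝ, max 0 (min t T) ≤ 1 := fun t => (hτT t).trans hT1.le
  have hbound : ∀ (v : ℝ × EuclideanSpace ℝ (Fin N) → ℝ) (R : ℝ), 0 ≤ R → (∀ q, |v q| ≤ R) →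
      ∀ q : ℝ × EuclideanSpace ℝ (Fin N),
        |picardMap N α p σ u₀ w v (max 0 (min q.1 T)) q.2| ≤
          B₀ * C + (T * (R ^ p * C) + T ^ (1 + σ) / (1 + σ) * (B₁ * C)) := by
    intro v R hR hv q
    have h1 : max 0 (min q.1 T) ^ (1 + σ) ≤ T ^ (1 + σ) :=
      Real.rpow_le_rpow (hτ0 _) (hτT _) (by linarith)
    have h2 : 0 ≤ R ^ p * C := by positivity
    have h3 : 0 < 1 + σ := by linarith
    refine (abs_picardMap_le hα hp hσ hB₀ hB₁ hR hu₀ hw hv (hτ0 _) (hτ1 _) q.2).trans ?_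
    rw [add_assoc]
    gcongr
    exact hτT _
  have hΦ : ∀ v : BoundedContinuousFunction (ℝ × EuclideanSpace ℝ (Fin N)) ℝ,
      ∃ v' : BoundedContinuousFunction (ℝ × EuclideanSpace ℝ (Fin N)) ℝ,
        ∀ q, v' q = picardMap N α p σ u₀ w v (max 0 (min q.1 T)) q.2 := fun v =>
    ⟨BoundedContinuousFunction.ofNormedAddCommGroup
      (fun q => picardMap N α p σ u₀ w v (max 0 (min q.1 T)) q.2)
      ((continuous_picardMap hα hp hσ hB₀ hB₁ (norm_nonneg v) hu₀c hwc hu₀ hw v.continuous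
        v.norm_coe_le_norm).comp
        (f := fun q : ℝ × EuclideanSpace ℝ (Fin N) => (max 0 (min q.1 T), q.2)) (by fun_prop))
      _ (hbound v ‖v‖ (norm_nonneg v) v.norm_coe_le_norm), fun q => rfl⟩
  choose Φ hΦ using hΦ
  have hball : ∀ {v : BoundedContinuousFunction (ℝ × EuclideanSpace ℝ (Fin N)) ℝ},
      v ∈ Metric.closedBall 0 M → ∀ q, |v q| ≤ M := fun hv q =>
    (BoundedContinuousFunction.norm_coe_le_norm _ q).trans (mem_closedBall_zero_iff.1 hv)
  have hmaps : MapsTo Φ (Metric.closedBall 0 M) (Metric.closedBall 0 M) := by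
    intro v hv
    rw [mem_closedBall_zero_iff, BoundedContinuousFunction.norm_le hM]
    intro q
    rw [hΦ, Real.norm_eq_abs]
    exact (hbound v M hM (hball hv) q).trans (by linarith)
  have hlip : ContractingWith (1 / 2) (hmaps.restrict Φ _ _) := by
    refine ⟨by norm_num, LipschitzWith.of_dist_le_mul fun v v' => ?_⟩
    rw [Subtype.dist_eq, Subtype.dist_eq, BoundedContinuousFunction.dist_le (by positivity)]
    intro q
    rw [MapsTo.val_restrict_apply, MapsTo.val_restrict_apply, hΦ, hΦ, Real.dist_eq]
    refine (abs_picardMap_sub_le hα hp v.1.continuous v'.1.continuous (hball v.2) (hball v'.2)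
      (fun q => BoundedContinuousFunction.dist_coe_le_dist (f := v.1) (g := v'.1) q)
      (hτ0 _) (hτ1 _) q.2).trans ?_
    refine mul_le_mul_of_nonneg_right ?_ dist_nonneg
    have hL : 0 ≤ p * M ^ (p - 1) * C := by positivity
    calc _ ≤ T * (p * M ^ (p - 1) * C) := mul_le_mul_of_nonneg_right (hτT _) hL
      _ ≤ _ := by simpa using hcontr.le
  obtain ⟨v, -, hfix, -⟩ := ContractingWith.exists_fixedPoint'
    (Metric.isClosed_closedBall.isComplete) hmaps hlip (Metric.mem_closedBall_self hM)
    (edist_ne_top _ _)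
  refine ⟨T, hT0, hT1, v, fun t ht x => ?_⟩
  have := hΦ v (t, x)
  rwa [hfix.eq, min_eq_left ht.2, max_eq_right ht.1] at this

/-- Local existence in the weighted space `C_ν` with `ν(x) = (1+|x|)^{α/(p-1)}`,
for `α > 0`: given continuous data `u₀, w` with `ν u₀, ν w` bounded, there are
`T > 0` and a continuous, `ν`-bounded mild solution on `[0,T]`. -/
theorem stmt_9 (N : ℕ) (hN : 1 ≤ N) (α p σ m : ℝ) (hα : 0 < α) (hp : 1 < p)
    (hσ : -1 < σ)
    (w : EuclideanSpace ℝ (Fin N) → ℝ) (hwc : Continuous w)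
    (hwb : ∃ B : ℝ, ∀ x, (1 + ‖x‖) ^ (α / (p - 1)) * |w x| ≤ B)
    (u₀ : EuclideanSpace ℝ (Fin N) → ℝ) (hu₀c : Continuous u₀)
    (hu₀b : ∃ B : ℝ, ∀ x, (1 + ‖x‖) ^ (α / (p - 1)) * |u₀ x| ≤ B) :
    ∃ T : ℝ, 0 < T ∧ ∃ u : ℝ → EuclideanSpace ℝ (Fin N) → ℝ,
      ContinuousOn (fun q : ℝ × EuclideanSpace ℝ (Fin N) => u q.1 q.2)
        (Set.Icc 0 T ×ˢ Set.univ) ∧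
      (∃ B : ℝ, ∀ t ∈ Set.Icc (0 : ℝ) T, ∀ x,
        (1 + ‖x‖) ^ (α / (p - 1)) * |u t x| ≤ B) ∧
      (∀ x, u 0 x = u₀ x) ∧
      ∀ t ∈ Set.Ioc (0 : ℝ) T, ∀ x,
        u t x = (∫ y, heatKernel N t (x - y) * u₀ y)
          + (∫ τ in (0 : ℝ)..t,
              ∫ y, heatKernel N (t - τ) (x - y) * ‖y‖ ^ α * |u τ y| ^ p)
          + ∫ τ in (0 : ℝ)..t, zeta σ m τ * ∫ y, heatKernel N (t - τ) (x - y) * w y := by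
  obtain ⟨B₁, hw⟩ := hwb
  obtain ⟨B₀, hu₀⟩ := hu₀b
  have hB₁ : 0 ≤ B₁ := le_trans (by positivity) (hw 0)
  have hB₀ : 0 ≤ B₀ := le_trans (by positivity) (hu₀ 0)
  obtain ⟨T, hT0, hT1, v, hv⟩ := exists_picardMap_fixedPoint hα.le hp hσ hu₀c hwc hB₀ hB₁
    (fun y => abs_le_mul_decayWeight (hu₀ y)) (fun y => abs_le_mul_decayWeight (hw y))
  have hmild : ∀ t ∈ Icc 0 T, ∀ x, decayWeight N (α / (p - 1)) x * v (t, x) =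
      heatFlow N u₀ t x + duhamel N 0 (reaction N α p v) t x + duhamel N σ (fun _ => w) t x := by
    intro t ht x
    rw [hv t ht x, picardMap, mul_inv_cancel_left₀ (decayWeight_pos _ x).ne']
  refine ⟨T, hT0, fun t x => decayWeight N (α / (p - 1)) x * v (t, x), ?_, ⟨‖v‖, ?_⟩, ?_, ?_⟩
  · have := continuous_decayWeight (N := N) (α / (p - 1))
    exact Continuous.continuousOn (by fun_prop)
  · intro t _ x
    rw [abs_mul, abs_of_pos (decayWeight_pos _ x), decayWeight, ← mul_assoc,
      ← Real.rpow_add (by positivity), add_neg_cancel, Real.rpow_zero, one_mul]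
    exact v.norm_coe_le_norm _
  · intro x
    dsimp only
    rw [hmild 0 ⟨le_rfl, hT0.le⟩ x, heatFlow_zero]
    simp [duhamel, Real.zero_rpow (show 1 + σ ≠ 0 by linarith)]
  · intro t ht x
    dsimp only
    rw [hmild t ⟨ht.1.le, ht.2⟩ x, heatFlow_eq_integral_heatKernel _ ht.1,
      duhamel_eq_integral_heatKernel _ ht.1, duhamel_eq_integral_heatKernel _ ht.1]
    congr 1
    · simp only [Real.rpow_zero, one_mul, reaction, mul_assoc]
    · refine intervalIntegral.integral_congr fun τ hτ => ?_
      rw [uIcc_of_le ht.1.le] at hτ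
      simp only [zeta, if_pos (hτ.2.trans_lt (ht.2.trans_lt hT1))]
end
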